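/- arXiv:2506.22324 — 2 statements merged into one kernel-verified Lean document; each statement's English description precedes it below -/
import Mathlib

section
/- Let (Ω, ℱ, P) be a probability space and let w, η, η_z be real random variables such that E[w·(η − η_z)²], E[(η − η_z)²], E[|w − w₁|·(η − η_z)²] and E[|w − w₁|·|η − η_z|] are finite, where w₁ ≠ 0 is a real constant. If E[w·(η − η_z)] = 0, then E[w·(η − η_z)²] = w₁·Var(η − η_z) + E[(w − w₁)·(η − η_z)]²/w₁ + E[(w − w₁)·(η − η_z)²]. Equivalently, with the effect size φ := 2·sd(η − η_z) and the approximation f_φ² := w₁·φ²/4, the quantity f² := E[w·(η − η_z)²] satisfies f² = f_φ² + E[(w − w₁)·(η − η_z)²] + E[(w − w₁)·(η − η_z)]²/w₁. -/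
open MeasureTheory ProbabilityTheory

/-- For real random variables `w, η, η_z` with the listed finite
expectations, a constant `w₁ ≠ 0`, and `E[w·(η − η_z)] = 0`, one has
`E[w·(η − η_z)²] = w₁·Var(η − η_z) + E[(w − w₁)·(η − η_z)]²/w₁ + E[(w − w₁)·(η − η_z)²]`.
Equivalently, with `φ := 2·sd(η − η_z)` and `f_φ² := w₁·φ²/4`, the quantity
`f² := E[w·(η − η_z)²]` satisfies
`f² = f_φ² + E[(w − w₁)·(η − η_z)²] + E[(w − w₁)·(η − η_z)]²/w₁`. -/
theorem fsq_decomposition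
    {Ω : Type*} {mΩ : MeasurableSpace Ω} (P : Measure Ω) [IsProbabilityMeasure P]
    (w η ηz : Ω → ℝ)
    (hw_meas : Measurable w) (hη_meas : Measurable η) (hηz_meas : Measurable ηz)
    (w₁ : ℝ) (hw₁ : w₁ ≠ 0)
    (h1 : Integrable (fun ω => w ω * (η ω - ηz ω) ^ 2) P)
    (h2 : Integrable (fun ω => (η ω - ηz ω) ^ 2) P)
    (h3 : Integrable (fun ω => |w ω - w₁| * (η ω - ηz ω) ^ 2) P)
    (h4 : Integrable (fun ω => |w ω - w₁| * |η ω - ηz ω|) P)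
    (hzero : ∫ ω, w ω * (η ω - ηz ω) ∂P = 0)
    -- the effect size measures
    (φ fφsq fsq : ℝ)
    (hφ : φ = 2 * Real.sqrt (variance (fun ω => η ω - ηz ω) P))
    (hfφsq : fφsq = w₁ * φ ^ 2 / 4)
    (hfsq : fsq = ∫ ω, w ω * (η ω - ηz ω) ^ 2 ∂P) :
    (∫ ω, w ω * (η ω - ηz ω) ^ 2 ∂P)
      = w₁ * variance (fun ω => η ω - ηz ω) P
        + (∫ ω, (w ω - w₁) * (η ω - ηz ω) ∂P) ^ 2 / w₁
        + ∫ ω, (w ω - w₁) * (η ω - ηz ω) ^ 2 ∂P ∧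
    fsq = fφsq + (∫ ω, (w ω - w₁) * (η ω - ηz ω) ^ 2 ∂P)
        + (∫ ω, (w ω - w₁) * (η ω - ηz ω) ∂P) ^ 2 / w₁ := by
  have hDm : Measurable (fun ω => η ω - ηz ω) := hη_meas.sub hηz_meas
  have hL2 : MemLp (fun ω => η ω - ηz ω) 2 P :=
    (memLp_two_iff_integrable_sq hDm.aestronglyMeasurable).2 h2
  have hD : Integrable (fun ω => η ω - ηz ω) P := hL2.integrable (by norm_num)
  have hwD : Integrable (fun ω => (w ω - w₁) * (η ω - ηz ω)) P := by
    refine h4.mono ((hw_meas.sub_const w₁).mul hDm).aestronglyMeasurable ?_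
    filter_upwards with ω
    simp [abs_mul]
  have e1 : ∫ ω, (w ω - w₁) * (η ω - ηz ω) ∂P = - (w₁ * ∫ ω, (η ω - ηz ω) ∂P) := by
    have h := integral_add hwD (hD.const_mul w₁)
    rw [integral_const_mul] at h
    have h' : ∫ ω, ((w ω - w₁) * (η ω - ηz ω) + w₁ * (η ω - ηz ω)) ∂P = 0 := by
      rw [← hzero]
      congr 1
      ext ω
      ring
    linarith
  have e2 : ∫ ω, (w ω - w₁) * (η ω - ηz ω) ^ 2 ∂P
      = (∫ ω, w ω * (η ω - ηz ω) ^ 2 ∂P) - w₁ * ∫ ω, (η ω - ηz ω) ^ 2 ∂P := by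
    rw [← integral_const_mul, ← integral_sub h1 (h2.const_mul w₁)]
    congr 1
    ext ω
    ring
  have e3 : variance (fun ω => η ω - ηz ω) P
      = (∫ ω, (η ω - ηz ω) ^ 2 ∂P) - (∫ ω, (η ω - ηz ω) ∂P) ^ 2 := by
    rw [variance_eq_sub hL2]
    rfl
  have main : (∫ ω, w ω * (η ω - ηz ω) ^ 2 ∂P)
      = w₁ * variance (fun ω => η ω - ηz ω) P
        + (∫ ω, (w ω - w₁) * (η ω - ηz ω) ∂P) ^ 2 / w₁
        + ∫ ω, (w ω - w₁) * (η ω - ηz ω) ^ 2 ∂P := by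
    rw [e1, e2, e3]
    field_simp
    ring
  refine ⟨main, ?_⟩
  have hs := Real.sq_sqrt (variance_nonneg (fun ω => η ω - ηz ω) P)
  rw [hfsq, main, hfφsq, hφ, mul_pow, hs]
  ring
end

section
/- Under the local-alternatives setup, f² is of exact order δβ²: there exist constants 0 < c ≤ C and δ' > 0 such that for all 0 ≤ δκ, δβ < δ', the matrix E[w·Z·Zᵀ] is invertible and c·δβ² ≤ f² ≤ C·δβ². -/
open MeasureTheory Matrix ProbabilityTheory

lemma aux_mul {Ω : Type*} {mΩ : MeasurableSpace Ω} {P : Measure Ω} {f g : Ω → ℝ}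
    (hf : MemLp f 4 P) (hg : MemLp g 4 P) : MemLp (fun ω => f ω * g ω) 2 P := by
  have : ENNReal.HolderTriple 4 4 2 := ⟨by
    have h4 : (4 : ENNReal) = 2 * 2 := by norm_num
    rw [h4, ENNReal.mul_inv (by simp) (by simp), ← mul_add, ENNReal.inv_two_add_inv_two, mul_one]⟩
  exact MemLp.mul' (r := 2) hg hf

lemma aux_int {Ω : Type*} {mΩ : MeasurableSpace Ω} {P : Measure Ω} {u f g : Ω → ℝ}
    (hu : MemLp u 2 P) (hf : MemLp f 4 P) (hg : MemLp g 4 P) :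
    Integrable (fun ω => u ω * f ω * g ω) P := by
  have := hu.integrable_mul (aux_mul hf hg)
  refine this.congr (Filter.Eventually.of_forall fun ω => ?_)
  simp [mul_assoc]

lemma aux_quad {Ω : Type*} {mΩ : MeasurableSpace Ω} {P : Measure Ω} {n : ℕ} {u S : Ω → ℝ}
    {Z : Ω → Fin n → ℝ} (hu : MemLp u 2 P) (hS : MemLp S 4 P)
    (hZ : ∀ j, MemLp (fun ω => Z ω j) 4 P) (a : Fin n → ℝ) :
    ∫ ω, u ω * (S ω - a ⬝ᵥ Z ω) ^ 2 ∂P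
      = ∫ ω, u ω * S ω * S ω ∂P - 2 * ∑ j, a j * ∫ ω, u ω * S ω * Z ω j ∂P
        + ∑ i, ∑ j, a i * a j * ∫ ω, u ω * Z ω i * Z ω j ∂P := by
  have e : ∀ ω, u ω * (S ω - a ⬝ᵥ Z ω) ^ 2 = u ω * S ω * S ω
      - 2 * ∑ j, a j * (u ω * S ω * Z ω j) + ∑ i, ∑ j, a i * a j * (u ω * Z ω i * Z ω j) := by
    intro ω
    have h1 : ∑ j, a j * (u ω * S ω * Z ω j) = u ω * S ω * (a ⬝ᵥ Z ω) := by
      simp only [dotProduct, Finset.mul_sum]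
      exact Finset.sum_congr rfl fun j _ => by ring
    have h2 : ∑ i, ∑ j, a i * a j * (u ω * Z ω i * Z ω j) = u ω * ((a ⬝ᵥ Z ω) * (a ⬝ᵥ Z ω)) := by
      simp only [dotProduct]
      rw [Finset.sum_mul_sum]
      simp only [Finset.mul_sum]
      exact Finset.sum_congr rfl fun j _ => Finset.sum_congr rfl fun j _ => by ring
    rw [h1, h2]; ring
  simp_rw [e]
  have i1 := aux_int hu hS hS
  have i2 : ∀ j, Integrable (fun ω => a j * (u ω * S ω * Z ω j)) P :=
    fun j => (aux_int hu hS (hZ j)).const_mul _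
  have i3 : ∀ i j, Integrable (fun ω => a i * a j * (u ω * Z ω i * Z ω j)) P :=
    fun i j => (aux_int hu (hZ i) (hZ j)).const_mul _
  have i2' : Integrable (fun ω => 2 * ∑ j, a j * (u ω * S ω * Z ω j)) P :=
    (integrable_finsetSum _ fun j _ => i2 j).const_mul _
  have i3' : ∀ i, Integrable (fun ω => ∑ j, a i * a j * (u ω * Z ω i * Z ω j)) P :=
    fun i => integrable_finsetSum _ fun j _ => i3 i j
  have i12 : Integrable (fun ω => u ω * S ω * S ω - 2 * ∑ j, a j * (u ω * S ω * Z ω j)) P :=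
    i1.sub i2'
  rw [integral_add i12 (integrable_finsetSum _ fun i _ => i3' i),
    integral_sub i1 i2', integral_const_mul, integral_finsetSum _ fun j _ => i2 j,
    integral_finsetSum _ fun i _ => i3' i]
  congr 1
  · simp_rw [integral_const_mul]
  · refine Finset.sum_congr rfl fun i _ => ?_
    rw [integral_finsetSum _ fun j _ => i3 i j]
    simp_rw [integral_const_mul]

lemma aux_cs {Ω : Type*} {mΩ : MeasurableSpace Ω} {P : Measure Ω} {u G : Ω → ℝ}
    (hu : MemLp u 2 P) (hG : MemLp G 2 P) {M t : ℝ} (ht : 0 < t)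
    (h : ∫ ω, u ω ^ 2 ∂P ≤ M * t ^ 2) :
    |∫ ω, u ω * G ω ∂P| ≤ t * (M + ∫ ω, G ω ^ 2 ∂P) := by
  have iu := hu.integrable_sq
  have iG := hG.integrable_sq
  have hiG : 0 ≤ ∫ ω, G ω ^ 2 ∂P := integral_nonneg fun ω => sq_nonneg _
  have hiu : 0 ≤ ∫ ω, u ω ^ 2 ∂P := integral_nonneg fun ω => sq_nonneg _
  calc |∫ ω, u ω * G ω ∂P| ≤ ∫ ω, |u ω * G ω| ∂P := abs_integral_le_integral_abs
    _ ≤ ∫ ω, (t⁻¹ * u ω ^ 2 + t * G ω ^ 2) ∂P := by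
        refine integral_mono (hu.integrable_mul hG).abs
          ((iu.const_mul _).add (iG.const_mul _)) fun ω => ?_
        have key : t * |u ω * G ω| ≤ t * (t⁻¹ * u ω ^ 2 + t * G ω ^ 2) := by
          have : t * (t⁻¹ * u ω ^ 2 + t * G ω ^ 2) = u ω ^ 2 + (t * G ω) ^ 2 := by
            field_simp
          rw [this, abs_mul, ← sq_abs (u ω), mul_pow, ← sq_abs (G ω)]
          nlinarith [sq_nonneg (|u ω| - t * |G ω|), sq_nonneg (|u ω| + t * |G ω|)]
        exact le_of_mul_le_mul_left key ht
    _ = t⁻¹ * ∫ ω, u ω ^ 2 ∂P + t * ∫ ω, G ω ^ 2 ∂P := by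
        rw [integral_add (iu.const_mul _) (iG.const_mul _), integral_const_mul,
          integral_const_mul]
    _ ≤ t⁻¹ * (M * t ^ 2) + t * ∫ ω, G ω ^ 2 ∂P := by gcongr
    _ = t * (M + ∫ ω, G ω ^ 2 ∂P) := by field_simp

/-- moment matrix -/
noncomputable def auxM {Ω : Type*} {mΩ : MeasurableSpace Ω} (P : Measure Ω) {n : ℕ}
    (Z : Ω → Fin n → ℝ) (u : Ω → ℝ) : Matrix (Fin n) (Fin n) ℝ :=
  Matrix.of fun i j => ∫ ω, u ω * Z ω i * Z ω j ∂P

noncomputable def auxb {Ω : Type*} {mΩ : MeasurableSpace Ω} (P : Measure Ω) {n : ℕ}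
    (Z : Ω → Fin n → ℝ) (S u : Ω → ℝ) : Fin n → ℝ :=
  fun j => ∫ ω, u ω * S ω * Z ω j ∂P

noncomputable def auxg {Ω : Type*} {mΩ : MeasurableSpace Ω} (P : Measure Ω) {n : ℕ}
    (Z : Ω → Fin n → ℝ) (S u : Ω → ℝ) : ℝ :=
  ∫ ω, u ω * (S ω - (auxb P Z S u ᵥ* (auxM P Z u)⁻¹) ⬝ᵥ Z ω) ^ 2 ∂P

lemma aux_tendsto {Ω α : Type*} {mΩ : MeasurableSpace Ω} {P : Measure Ω} {n : ℕ}
    {Z : Ω → Fin n → ℝ} {S us : Ω → ℝ} {u : α → Ω → ℝ} {l : Filter α}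
    (hS : MemLp S 4 P) (hZ : ∀ j, MemLp (fun ω => Z ω j) 4 P)
    (hus : MemLp us 2 P) (hu : ∀ᶠ x in l, MemLp (u x) 2 P)
    (hlim : ∀ G : Ω → ℝ, MemLp G 2 P →
      Filter.Tendsto (fun x => ∫ ω, u x ω * G ω ∂P) l (nhds (∫ ω, us ω * G ω ∂P)))
    (hM : IsUnit (auxM P Z us)) :
    (∀ᶠ x in l, IsUnit (auxM P Z (u x))) ∧
    Filter.Tendsto (fun x => auxg P Z S (u x)) l (nhds (auxg P Z S us)) := by
  have hlim2 : ∀ f g : Ω → ℝ, MemLp f 4 P → MemLp g 4 P →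
      Filter.Tendsto (fun x => ∫ ω, u x ω * f ω * g ω ∂P) l (nhds (∫ ω, us ω * f ω * g ω ∂P)) := by
    intro f g hf hg
    simpa only [mul_assoc] using hlim _ (aux_mul hf hg)
  have tM : Filter.Tendsto (fun x => auxM P Z (u x)) l (nhds (auxM P Z us)) := by
    refine tendsto_pi_nhds.2 fun i => tendsto_pi_nhds.2 fun j => ?_
    exact hlim2 _ _ (hZ i) (hZ j)
  have tb : Filter.Tendsto (fun x => auxb P Z S (u x)) l (nhds (auxb P Z S us)) := by
    refine tendsto_pi_nhds.2 fun j => ?_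
    exact hlim2 _ _ hS (hZ j)
  have hdet : (auxM P Z us).det ≠ 0 := by
    have := (Matrix.isUnit_iff_isUnit_det _).1 hM
    exact this.ne_zero
  have tdet : Filter.Tendsto (fun x => (auxM P Z (u x)).det) l (nhds (auxM P Z us).det) :=
    ((Continuous.matrix_det continuous_id).tendsto _).comp tM
  have hev := tdet.eventually_ne hdet
  refine ⟨hev.mono fun x hx => (Matrix.isUnit_iff_isUnit_det _).2 hx.isUnit, ?_⟩
  have tinv : Filter.Tendsto (fun x => (auxM P Z (u x))⁻¹) l (nhds (auxM P Z us)⁻¹) := by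
    simp only [Matrix.inv_def, Ring.inverse_eq_inv']
    exact (tdet.inv₀ hdet).smul
      (((Continuous.matrix_adjugate continuous_id).tendsto _).comp tM)
  have ta : Filter.Tendsto (fun x => auxb P Z S (u x) ᵥ* (auxM P Z (u x))⁻¹) l
      (nhds (auxb P Z S us ᵥ* (auxM P Z us)⁻¹)) := by
    have c : Continuous fun y : (Fin n → ℝ) × Matrix (Fin n) (Fin n) ℝ => y.1 ᵥ* y.2 :=
      Continuous.matrix_vecMul continuous_fst continuous_snd
    exact (c.tendsto _).comp (tb.prodMk_nhds tinv)
  have taj := fun j => (tendsto_pi_nhds.1 ta) j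
  have main : Filter.Tendsto (fun x => ∫ ω, u x ω * S ω * S ω ∂P
      - 2 * ∑ j, (auxb P Z S (u x) ᵥ* (auxM P Z (u x))⁻¹) j * ∫ ω, u x ω * S ω * Z ω j ∂P
        + ∑ i, ∑ j, (auxb P Z S (u x) ᵥ* (auxM P Z (u x))⁻¹) i
          * (auxb P Z S (u x) ᵥ* (auxM P Z (u x))⁻¹) j * ∫ ω, u x ω * Z ω i * Z ω j ∂P) l
      (nhds (auxg P Z S us)) := by
    rw [auxg, aux_quad hus hS hZ]
    refine ((hlim2 _ _ hS hS).sub ((tendsto_finsetSum _ fun j _ => ?_).const_mul 2)).add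
      (tendsto_finsetSum _ fun i _ => tendsto_finsetSum _ fun j _ => ?_)
    · exact (taj j).mul (hlim2 _ _ hS (hZ j))
    · exact ((taj i).mul (taj j)).mul (hlim2 _ _ (hZ i) (hZ j))
  refine main.congr' ?_
  filter_upwards [hu] with x hx
  rw [auxg, aux_quad hx hS hZ]

lemma aux_memLp {Ω : Type*} {mΩ : MeasurableSpace Ω} {P : Measure Ω} {n : ℕ}
    {Y : Ω → Fin n → ℝ} (hY : Measurable Y)
    (hi : Integrable (fun ω => Real.sqrt (∑ k, Y ω k ^ 2) ^ 4) P) (j : Fin n) :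
    MemLp (fun ω => Y ω j) 4 P := by
  have hm : Measurable fun ω => Y ω j := (measurable_pi_apply j).comp hY
  rw [← integrable_norm_rpow_iff hm.aestronglyMeasurable (by norm_num) (by norm_num)]
  refine hi.mono' (hm.norm.pow_const _).aestronglyMeasurable (Filter.Eventually.of_forall fun ω => ?_)
  have h1 : |Y ω j| ≤ Real.sqrt (∑ k, Y ω k ^ 2) := by
    apply Real.abs_le_sqrt
    exact Finset.single_le_sum (f := fun k => Y ω k ^ 2) (fun k _ => sq_nonneg _)
      (Finset.mem_univ j)
  have e : (4 : ENNReal).toReal = ((4 : ℕ) : ℝ) := by norm_num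
  rw [e, Real.rpow_natCast, Real.norm_eq_abs, Real.norm_eq_abs, abs_of_nonneg (by positivity)]
  gcongr

lemma aux_resid {Ω : Type*} {mΩ : MeasurableSpace Ω} {P : Measure Ω} {n : ℕ} {u S : Ω → ℝ}
    {Z : Ω → Fin n → ℝ} (hu : MemLp u 2 P) (hS : MemLp S 4 P)
    (hZ : ∀ j, MemLp (fun ω => Z ω j) 4 P) (hM : IsUnit (auxM P Z u)) (v : Fin n → ℝ) (d : ℝ)
    (e : Ω → ℝ) (he : ∀ ω, e ω = v ⬝ᵥ Z ω + d * S ω) :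
    ∫ ω, u ω * (e ω - (fun j => ∫ ω', u ω' * e ω' * Z ω' j ∂P)
          ⬝ᵥ ((auxM P Z u)⁻¹ *ᵥ Z ω)) ^ 2 ∂P = d ^ 2 * auxg P Z S u := by
  have hb : (fun j => ∫ ω', u ω' * e ω' * Z ω' j ∂P) = v ᵥ* auxM P Z u + d • auxb P Z S u := by
    funext j
    have e1 : ∀ ω, u ω * e ω * Z ω j
        = ∑ i, v i * (u ω * Z ω i * Z ω j) + d * (u ω * S ω * Z ω j) := by
      intro ω
      have : ∑ i, v i * (u ω * Z ω i * Z ω j) = u ω * (v ⬝ᵥ Z ω) * Z ω j := by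
        simp only [dotProduct, Finset.mul_sum, Finset.sum_mul]
        exact Finset.sum_congr rfl fun j _ => by ring
      rw [this, he]; ring
    simp_rw [e1]
    have i1 : ∀ i, Integrable (fun ω => v i * (u ω * Z ω i * Z ω j)) P :=
      fun i => (aux_int hu (hZ i) (hZ j)).const_mul _
    rw [integral_add (integrable_finsetSum _ fun i _ => i1 i)
      ((aux_int hu hS (hZ j)).const_mul _), integral_finsetSum _ fun i _ => i1 i]
    simp_rw [integral_const_mul]
    simp [vecMul, dotProduct, auxM, auxb]
  have hdet : IsUnit (auxM P Z u).det := (Matrix.isUnit_iff_isUnit_det _).1 hM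
  rw [hb, auxg, ← integral_const_mul]
  refine integral_congr_ae (Filter.Eventually.of_forall fun ω => ?_)
  simp only
  have : (v ᵥ* auxM P Z u + d • auxb P Z S u) ⬝ᵥ ((auxM P Z u)⁻¹ *ᵥ Z ω)
      = v ⬝ᵥ Z ω + d * ((auxb P Z S u ᵥ* (auxM P Z u)⁻¹) ⬝ᵥ Z ω) := by
    rw [add_dotProduct, smul_dotProduct, smul_eq_mul, dotProduct_mulVec, dotProduct_mulVec,
      vecMul_vecMul, Matrix.mul_nonsing_inv _ hdet, vecMul_one]
  rw [this, he]; ring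

/-- Under the local-alternatives setup, `f²` is of exact order `δβ²`:
there exist constants `0 < c ≤ C` and `δ' > 0` such that for all `0 ≤ δκ, δβ < δ'`, the
matrix `E[w·Z·Zᵀ]` is invertible and `c·δβ² ≤ f² ≤ C·δβ²`. -/
theorem fsq_order_delta_beta_sq
    {Ω : Type*} {mΩ : MeasurableSpace Ω} (P : Measure Ω) [IsProbabilityMeasure P]
    {p q : ℕ} (X : Ω → Fin p → ℝ) (Z0 : Ω → Fin q → ℝ)
    (hX_meas : Measurable X) (hZ0_meas : Measurable Z0)
    -- Z = (1, Z₀)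
    (Z : Ω → Fin (q + 1) → ℝ) (hZ : ∀ ω, Z ω = Fin.cons 1 (Z0 ω))
    (μs : ℝ) (κs : Fin q → ℝ) (βs : Fin p → ℝ)
    -- inverse link and variance function
    (h V : ℝ → ℝ) (hh : ContDiff ℝ 1 h) (hV_cont : Continuous V)
    (hV_pos : ∀ t, 0 < V t)
    -- linear predictor and weight, as functions of (ι, δκ, δβ)
    (η : ℝ → ℝ → ℝ → Ω → ℝ)
    (hη_def : ∀ i dκ dβ ω, η i dκ dβ ω = i + dκ * (κs ⬝ᵥ Z0 ω) + dβ * (βs ⬝ᵥ X ω))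
    (w : ℝ → ℝ → ℝ → Ω → ℝ)
    (hw_def : ∀ i dκ dβ ω, w i dκ dβ ω
      = (deriv h (η i dκ dβ ω)) ^ 2 / V (h (η i dκ dβ ω)))
    (ηs : ℝ) (hηs : h ηs = μs)
    (ws : ℝ) (hws : ws = (deriv h ηs) ^ 2 / V μs)
    -- bounded moments up to fourth order
    (hmom : ∀ i j : ℕ, 1 ≤ i + j → i + j ≤ 4 → Integrable (fun ω =>
      Real.sqrt (∑ k, X ω k ^ 2) ^ i * Real.sqrt (∑ k, Z ω k ^ 2) ^ j) P)
    -- regularity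
    (hws_ne : ws ≠ 0)
    (Mzzs : Matrix (Fin (q + 1)) (Fin (q + 1)) ℝ)
    (hMzzs : Mzzs = Matrix.of fun i j => ∫ ω, ws * Z ω i * Z ω j ∂P)
    (hMzzs_inv : IsUnit Mzzs)
    (As : Matrix (Fin p) (Fin (q + 1)) ℝ)
    (hAs : As = (Matrix.of fun i j => ∫ ω, ws * X ω i * Z ω j ∂P) * Mzzs⁻¹)
    (hreg : 0 < ∫ ω, ws * (βs ⬝ᵥ (X ω - As *ᵥ Z ω)) ^ 2 ∂P)
    -- mean constraint
    (ι : ℝ → ℝ → ℝ) (δ₀ : ℝ) (hδ₀ : 0 < δ₀)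
    (hmean : ∀ dκ dβ : ℝ, 0 ≤ dκ → dκ < δ₀ → 0 ≤ dβ → dβ < δ₀ →
      ∫ ω, h (η (ι dκ dβ) dκ dβ ω) ∂P = μs)
    -- smoothness of w
    (M δstar : ℝ) (hM : 0 ≤ M) (hδstar : 0 < δstar)
    (hsmooth : ∀ dκ dβ : ℝ, 0 ≤ dκ → dκ < δstar → 0 ≤ dβ → dβ < δstar →
      Integrable (fun ω => (w (ι dκ dβ) dκ dβ ω - ws) ^ 2) P ∧
      ∫ ω, (w (ι dκ dβ) dκ dβ ω - ws) ^ 2 ∂P ≤ M * (dκ + dβ) ^ 2)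
    -- derived quantities (for parameter values where E[w·Z·Zᵀ] is invertible)
    (Mzz : ℝ → ℝ → ℝ → Matrix (Fin (q + 1)) (Fin (q + 1)) ℝ)
    (hMzz : ∀ i dκ dβ, Mzz i dκ dβ
      = Matrix.of fun k j => ∫ ω, w i dκ dβ ω * Z ω k * Z ω j ∂P)
    (A : ℝ → ℝ → ℝ → Matrix (Fin p) (Fin (q + 1)) ℝ)
    (hA : ∀ i dκ dβ, A i dκ dβ
      = (Matrix.of fun k j => ∫ ω, w i dκ dβ ω * X ω k * Z ω j ∂P) * (Mzz i dκ dβ)⁻¹)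
    (ηz : ℝ → ℝ → ℝ → Ω → ℝ)
    (hηz : ∀ i dκ dβ ω, ηz i dκ dβ ω
      = (fun j => ∫ ω', w i dκ dβ ω' * η i dκ dβ ω' * Z ω' j ∂P)
          ⬝ᵥ ((Mzz i dκ dβ)⁻¹ *ᵥ Z ω))
    (fsq : ℝ → ℝ → ℝ → ℝ)
    (hfsq : ∀ i dκ dβ, fsq i dκ dβ
      = ∫ ω, w i dκ dβ ω * (η i dκ dβ ω - ηz i dκ dβ ω) ^ 2 ∂P)
    (fφsq : ℝ → ℝ → ℝ → ℝ)
    (hfφsq : ∀ i dκ dβ, fφsq i dκ dβ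
      = ws * variance (fun ω => η i dκ dβ ω - ηz i dκ dβ ω) P)
    :
    ∃ c C δ' : ℝ, 0 < c ∧ c ≤ C ∧ 0 < δ' ∧
      ∀ dκ dβ : ℝ, 0 ≤ dκ → dκ < δ' → 0 ≤ dβ → dβ < δ' →
        IsUnit (Mzz (ι dκ dβ) dκ dβ) ∧
        c * dβ ^ 2 ≤ fsq (ι dκ dβ) dκ dβ ∧
        fsq (ι dκ dβ) dκ dβ ≤ C * dβ ^ 2 := by
  have hZ_meas : Measurable Z := by
    refine measurable_pi_iff.2 fun j => ?_
    have : (fun ω => Z ω j) = fun ω => (Fin.cons 1 (Z0 ω) : Fin (q + 1) → ℝ) j := by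
      funext ω; rw [hZ]
    rw [this]
    refine Fin.cases ?_ (fun k => ?_) j
    · simp
    · simpa only [Fin.cons_succ] using measurable_pi_iff.1 hZ0_meas k
  have hZ4 : ∀ j, MemLp (fun ω => Z ω j) 4 P :=
    aux_memLp hZ_meas (by simpa using hmom 0 4 (by norm_num) (by norm_num))
  have hX4 : ∀ j, MemLp (fun ω => X ω j) 4 P :=
    aux_memLp hX_meas (by simpa using hmom 4 0 (by norm_num) (by norm_num))
  set S : Ω → ℝ := fun ω => βs ⬝ᵥ X ω with hSdef
  have hS4 : MemLp S 4 P := by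
    simp only [hSdef, dotProduct]
    exact memLp_finsetSum _ fun j _ => (hX4 j).const_mul _
  have hus : MemLp (fun _ : Ω => ws) 2 P := memLp_const _
  have hη_meas : ∀ i a b, Measurable (η i a b) := by
    intro i a b
    have : η i a b = fun ω => i + a * (κs ⬝ᵥ Z0 ω) + b * (βs ⬝ᵥ X ω) := funext (hη_def i a b)
    rw [this]
    simp only [dotProduct]
    fun_prop
  have hw_meas : ∀ i a b, Measurable (w i a b) := by
    intro i a b
    have : w i a b = fun ω => (deriv h (η i a b ω)) ^ 2 / V (h (η i a b ω)) :=
      funext (hw_def i a b)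
    rw [this]
    have h1 : Measurable (deriv h) := measurable_deriv h
    have h2 : Measurable h := hh.continuous.measurable
    have h3 := hV_cont.measurable
    have h4 := hη_meas i a b
    fun_prop
  have hMs : Mzzs = auxM P Z (fun _ => ws) := hMzzs
  -- limit weight
  have hgs : 0 < auxg P Z S (fun _ => ws) := by
    have e : ∀ ω, βs ⬝ᵥ (X ω - As *ᵥ Z ω)
        = S ω - (auxb P Z S (fun _ => ws) ᵥ* (auxM P Z (fun _ => ws))⁻¹) ⬝ᵥ Z ω := by
      intro ω
      have hbb : βs ᵥ* (Matrix.of fun i j => ∫ ω, ws * X ω i * Z ω j ∂P)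
          = auxb P Z S (fun _ => ws) := by
        funext j
        have e1 : ∀ ω, ws * S ω * Z ω j = ∑ i, βs i * (ws * X ω i * Z ω j) := by
          intro ω
          simp only [hSdef, dotProduct, Finset.mul_sum, Finset.sum_mul]
          exact Finset.sum_congr rfl fun j _ => by ring
        simp only [auxb, e1]
        rw [integral_finsetSum _ fun i _ => (aux_int hus (hX4 i) (hZ4 j)).const_mul _]
        simp_rw [integral_const_mul]
        simp [vecMul, dotProduct]
      rw [dotProduct_sub, dotProduct_mulVec, hAs, ← vecMul_vecMul, hbb, hMs]
    rw [auxg]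
    simpa only [e] using hreg
  set gs := auxg P Z S (fun _ => ws) with hgsdef
  set l : Filter (ℝ × ℝ) := nhdsWithin (0, 0) (Set.Ici 0 ×ˢ Set.Ici 0) with hl
  have hsmall : ∀ t > 0, ∀ᶠ x : ℝ × ℝ in l, 0 ≤ x.1 ∧ x.1 < t ∧ 0 ≤ x.2 ∧ x.2 < t := by
    intro t ht
    have h1 : ∀ᶠ x : ℝ × ℝ in l, x ∈ Set.Ici (0 : ℝ) ×ˢ Set.Ici (0 : ℝ) := self_mem_nhdsWithin
    have h2 : ∀ᶠ x : ℝ × ℝ in l, x.1 < t :=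
      nhdsWithin_le_nhds ((continuous_fst.tendsto ((0 : ℝ), (0 : ℝ))).eventually_lt_const ht)
    have h3 : ∀ᶠ x : ℝ × ℝ in l, x.2 < t :=
      nhdsWithin_le_nhds ((continuous_snd.tendsto ((0 : ℝ), (0 : ℝ))).eventually_lt_const ht)
    filter_upwards [h1, h2, h3] with x a b c
    exact ⟨a.1, b, a.2, c⟩
  let u : ℝ × ℝ → Ω → ℝ := fun x => w (ι x.1 x.2) x.1 x.2
  have hdiff : ∀ᶠ x in l, MemLp (fun ω => u x ω - ws) 2 P := by
    filter_upwards [hsmall δstar hδstar] with x hx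
    have := (hsmooth x.1 x.2 hx.1 hx.2.1 hx.2.2.1 hx.2.2.2).1
    exact (memLp_two_iff_integrable_sq
      ((hw_meas _ _ _).sub_const ws).aestronglyMeasurable).2 this
  have hu : ∀ᶠ x in l, MemLp (u x) 2 P := by
    filter_upwards [hdiff] with x hx
    have := hx.add hus
    refine this.congr_norm (hw_meas _ _ _).aestronglyMeasurable
      (Filter.Eventually.of_forall fun ω => ?_)
    simp
  have hlim : ∀ G : Ω → ℝ, MemLp G 2 P →
      Filter.Tendsto (fun x => ∫ ω, u x ω * G ω ∂P) l (nhds (∫ ω, ws * G ω ∂P)) := by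
    intro G hG
    rw [Metric.tendsto_nhds]
    intro ε hε
    set K := ∫ ω, G ω ^ 2 ∂P
    have hK : 0 ≤ K := integral_nonneg fun ω => sq_nonneg _
    set t := ε / (M + K + 1) with htdef
    have hden : 0 < M + K + 1 := by positivity
    have ht : 0 < t := by positivity
    filter_upwards [hsmall δstar hδstar, hsmall (t / 2) (by positivity), hdiff, hu]
      with x hx hxt hd hux
    have hb := (hsmooth x.1 x.2 hx.1 hx.2.1 hx.2.2.1 hx.2.2.2).2
    have hb2 : ∫ ω, (u x ω - ws) ^ 2 ∂P ≤ M * t ^ 2 := by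
      refine hb.trans ?_
      have : 0 ≤ x.1 + x.2 := add_nonneg hx.1 hx.2.2.1
      have : x.1 + x.2 ≤ t := by linarith [hxt.2.1, hxt.2.2.2]
      gcongr
    have hc := aux_cs hd hG ht hb2
    have i1 : Integrable (fun ω => u x ω * G ω) P := hux.integrable_mul hG
    have i2 : Integrable (fun ω => ws * G ω) P := hus.integrable_mul hG
    rw [Real.dist_eq, ← integral_sub i1 i2]
    simp_rw [← sub_mul]
    refine hc.trans_lt ?_
    have : t * (M + K + 1) = ε := by rw [htdef]; field_simp
    change t * (M + K) < ε
    nlinarith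
  obtain ⟨hunit, hg⟩ := aux_tendsto hS4 hZ4 hus hu hlim (hMs ▸ hMzzs_inv)
  have hev : ∀ᶠ x in l, IsUnit (auxM P Z (u x)) ∧ MemLp (u x) 2 P ∧
      gs / 2 < auxg P Z S (u x) ∧ auxg P Z S (u x) < 2 * gs := by
    filter_upwards [hunit, hu, hg.eventually_const_lt (show gs / 2 < gs by linarith),
      hg.eventually_lt_const (show gs < 2 * gs by linarith)] with x a b c d
    exact ⟨a, b, c, d⟩
  obtain ⟨δ', hδ', hball⟩ := Metric.mem_nhdsWithin_iff.1 hev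
  refine ⟨gs / 2, 2 * gs, δ', by linarith, by linarith, hδ', ?_⟩
  intro dκ dβ h1 h2 h3 h4
  have hmem : (dκ, dβ) ∈ Metric.ball ((0 : ℝ), (0 : ℝ)) δ' ∩ Set.Ici 0 ×ˢ Set.Ici 0 := by
    refine ⟨?_, h1, h3⟩
    rw [Metric.mem_ball, Prod.dist_eq]
    simp only [Real.dist_eq, sub_zero, abs_of_nonneg h1, abs_of_nonneg h3]
    exact max_lt h2 h4
  obtain ⟨a1, a2, a3, a4⟩ := hball hmem
  have hMe : Mzz (ι dκ dβ) dκ dβ = auxM P Z (u (dκ, dβ)) := hMzz _ _ _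
  have hf : fsq (ι dκ dβ) dκ dβ = dβ ^ 2 * auxg P Z S (u (dκ, dβ)) := by
    rw [hfsq]
    simp_rw [hηz, hMe]
    refine aux_resid a2 hS4 hZ4 a1 (Fin.cons (ι dκ dβ) (dκ • κs)) dβ _ fun ω => ?_
    rw [hη_def, hZ]
    simp [dotProduct, Fin.sum_univ_succ, hSdef, Finset.mul_sum, mul_assoc]
  refine ⟨hMe ▸ a1, ?_, ?_⟩
  · rw [hf]; nlinarith [sq_nonneg dβ]
  · rw [hf]; nlinarith [sq_nonneg dβ]
end
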